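/- Let K ⊆ L be a purely transcendental field extension, let A and B be two nonzero finite-dimensional K-subspaces of L of the same dimension, and let f, g : A → B be two equivalent K-linear isomorphisms. Then either f = c·g for some nonzero constant c ∈ K, or B = αA for some nonzero constant α ∈ L. Moreover, in the latter case, if the equivalence between f and g is given by a K-linear automorphism φ : A → A (so that a·f(a) = φ(a)·g(φ(a)) for all a ∈ A), then the composition g ∘ φ : A → B is the map of multiplication by α. -/

import Mathlib

/-- A field extension `K ⊆ L` is purely transcendental if `L` is generated, as a field
extension of `K`, by an algebraically independent set. -/
def IsPurelyTranscendental (K L : Type*) [Field K] [Field L] [Algebra K L] : Prop :=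
  ∃ S : Set L, AlgebraicIndependent K ((↑) : S → L) ∧ IntermediateField.adjoin K S = ⊤

/-- Elements of a purely transcendental extension which are integral over the base lie in it. -/
theorem mem_base_of_isIntegral {K L : Type*} [Field K] [Field L] [Algebra K L]
    (hKL : IsPurelyTranscendental K L) (β : L) (hβ : IsIntegral K β) :
    ∃ b : K, algebraMap K L b = β := by
  obtain ⟨S, hS, hT⟩ := hKL
  have hm : β ∈ IntermediateField.adjoin K S := by rw [hT]; trivial
  obtain ⟨r, s, hrs⟩ := (IntermediateField.mem_adjoin_iff K β).1 hm
  by_cases h0 : MvPolynomial.aeval (Subtype.val : S → L) s = 0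
  · exact ⟨0, by simp [hrs, h0]⟩
  have hs : s ≠ 0 := by rintro rfl; simp at h0
  have hF := hS.algebraicClosure
  let b : algebraicClosure K L := ⟨β, (mem_algebraicClosure_iff).2 hβ.isAlgebraic⟩
  have key : MvPolynomial.C b * MvPolynomial.map (algebraMap K (algebraicClosure K L)) s
      = MvPolynomial.map (algebraMap K (algebraicClosure K L)) r := by
    apply hF
    simp only [map_mul, MvPolynomial.aeval_map_algebraMap, MvPolynomial.aeval_C]
    have : algebraMap (algebraicClosure K L) L b = β := rfl
    rw [this, hrs]
    field_simp
  obtain ⟨m, hm⟩ := MvPolynomial.ne_zero_iff.1 hs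
  have h1 := congrArg (MvPolynomial.coeff m) key
  rw [MvPolynomial.coeff_C_mul, MvPolynomial.coeff_map, MvPolynomial.coeff_map] at h1
  have h2 := congrArg (algebraMap (algebraicClosure K L) L) h1
  rw [map_mul, ← IsScalarTower.algebraMap_apply, ← IsScalarTower.algebraMap_apply] at h2
  have h3 : algebraMap K L (s.coeff m) ≠ 0 := by simpa using hm
  refine ⟨r.coeff m / s.coeff m, ?_⟩
  rw [map_div₀, ← h2, mul_div_assoc, div_self h3, mul_one]
  rfl

/-- Let `K ⊆ L` be a purely transcendental field extension, `A`, `B` nonzero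
finite-dimensional `K`-subspaces of `L` of the same dimension and `f, g : A → B`
equivalent `K`-linear isomorphisms, the equivalence being given by a `K`-linear
automorphism `φ : A → A` with `a * f a = φ a * g (φ a)` for all `a ∈ A`. Then either
`f = c • g` for some nonzero `c ∈ K`, or `B = α • A` for some nonzero `α ∈ L` and
moreover `g ∘ φ` is multiplication by `α`. -/
theorem stmt14 {K L : Type*} [Field K] [Field L] [Algebra K L]
    (hKL : IsPurelyTranscendental K L)
    (A B : Submodule K L) (hA : A ≠ ⊥) (hB : B ≠ ⊥)
    [FiniteDimensional K A] [FiniteDimensional K B]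
    (hdim : Module.finrank K A = Module.finrank K B)
    (f g : A ≃ₗ[K] B) (φ : A ≃ₗ[K] A)
    (hφ : ∀ a : A, (a : L) * ((f a : ↥B) : L) = ((φ a : ↥A) : L) * ((g (φ a) : ↥B) : L)) :
    (∃ c : K, c ≠ 0 ∧ ∀ a : A, ((f a : ↥B) : L) = algebraMap K L c * ((g a : ↥B) : L)) ∨
    (∃ α : L, α ≠ 0 ∧ (B : Set L) = (α * ·) '' (A : Set L) ∧
      ∀ a : A, ((g (φ a) : ↥B) : L) = α * (a : L)) := by
  obtain ⟨e, heA, he⟩ := Submodule.exists_mem_ne_zero_of_ne_bot hA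
  let e' : A := ⟨e, heA⟩
  let F : A →ₗ[K] L := B.subtype ∘ₗ f.toLinearMap
  let P : A →ₗ[K] L := A.subtype ∘ₗ φ.toLinearMap
  let G : A →ₗ[K] L := B.subtype ∘ₗ g.toLinearMap ∘ₗ φ.toLinearMap
  have h : ∀ a : A, (a : L) * F a = P a * G a := hφ
  let p : A →ₗ[K] L := e • P - (P e') • A.subtype
  let q : A →ₗ[K] L := e • G - (G e') • A.subtype
  have hp : ∀ x : A, p x = e * P x - P e' * x := fun x => rfl
  have hq : ∀ x : A, q x = e * G x - G e' * x := fun x => rfl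
  have hpq : ∀ x : A, p x * q x = 0 := by
    intro x
    have h1 := h x
    have h2 : e * F e' = P e' * G e' := h e'
    have h3 := h (x + e')
    simp only [map_add, Submodule.coe_add] at h3
    have h4 : (e' : L) = e := rfl
    rw [h4] at h3
    rw [hp, hq]
    linear_combination (-e ^ 2 - e * x) * h1 + (-(x : L) ^ 2 - e * x) * h2 + e * x * h3
  have hcase : (∀ x, p x = 0) ∨ (∀ x, q x = 0) := by
    by_contra! hc
    obtain ⟨⟨x, hx⟩, y, hy⟩ := hc
    have hqx : q x = 0 := (mul_eq_zero.1 (hpq x)).resolve_left hx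
    have hpy : p y = 0 := (mul_eq_zero.1 (hpq y)).resolve_right hy
    have := hpq (x + y)
    rw [map_add, map_add, hqx, hpy, add_zero, zero_add] at this
    exact mul_ne_zero hx hy this
  rcases hcase with hc | hc
  · left
    have hP : ∀ x : A, ((φ x : A) : L) = (P e' / e) * x := by
      intro x
      have h1 : e * ((φ x : A) : L) - P e' * x = 0 := (hp x).symm.trans (hc x)
      field_simp
      linear_combination h1
    obtain ⟨b, hb⟩ := mem_base_of_isIntegral hKL (P e' / e)
      (isIntegral_of_smul_mem_submodule A hA (Module.Finite.iff_fg.1 inferInstance) _ (by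
        intro n hn
        rw [smul_eq_mul, ← hP ⟨n, hn⟩]
        exact (φ ⟨n, hn⟩).2))
    have hφb : ∀ x : A, φ x = b • x := by
      intro x
      apply Subtype.ext
      rw [hP, ← hb, Submodule.coe_smul, Algebra.smul_def]
    have hb0 : b ≠ 0 := by
      rintro rfl
      have h1 : φ e' = 0 := by rw [hφb, zero_smul]
      have h2 : e' = 0 := by simpa using h1
      exact he (congrArg Subtype.val h2)
    refine ⟨b ^ 2, pow_ne_zero 2 hb0, fun a => ?_⟩
    by_cases ha : a = 0
    · simp [ha]
    have ha' : (a : L) ≠ 0 := by simpa using ha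
    have h1 := hφ a
    rw [hφb, map_smul, Submodule.coe_smul, Submodule.coe_smul, Algebra.smul_def,
      Algebra.smul_def] at h1
    apply mul_left_cancel₀ ha'
    rw [h1, map_pow]
    ring
  · right
    have hG : ∀ x : A, ((g (φ x) : B) : L) = (G e' / e) * x := by
      intro x
      have h1 : e * ((g (φ x) : B) : L) - G e' * x = 0 := (hq x).symm.trans (hc x)
      field_simp
      linear_combination h1
    refine ⟨G e' / e, ?_, ?_, hG⟩
    · intro h0
      have h1 := hG e'
      rw [h0, zero_mul] at h1
      have h2 : e' = 0 := by simpa using h1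
      exact he (congrArg Subtype.val h2)
    · ext y
      constructor
      · intro hy
        refine ⟨(φ.symm (g.symm ⟨y, hy⟩) : A), Subtype.property _, ?_⟩
        simp only
        rw [← hG]
        simp
      · rintro ⟨x, hx, rfl⟩
        simp only
        have := hG ⟨x, hx⟩
        simp only at this
        rw [← this]
        exact Subtype.property _
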